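/- Consider Prox-SDCA with Option I updates. Assume each φ_i is L-Lipschitz with respect to ‖·‖_P, g is 1-strongly convex with respect to ‖·‖_{P'}, φ_i ≥ 0, (1/n)∑_i φ_i(0) ≤ 1, and ‖X_i‖ ≤ R. Let ε_P > 0, let t₀ = max(0, ⌈n log(λn/(2(RL)²))⌉), let T₀ ≥ max(t₀, t₀ + 16(RL)²/(λ ε_P) − 2n), and let T ≥ T₀ + max(n, 4(RL)²/(λ ε_P)). Then: (i) the expected average duality gap satisfies E[ (1/(T−T₀)) ∑_{t=T₀+1}^{T} (P(w^{(t−1)}) − D(α^{(t−1)})) ] ≤ ε_P; and (ii) for every t ≥ t₀, the expected dual sub-optimality satisfies E[ D(α*) − D(α^{(t)}) ] ≤ 8(RL)² / (λ(2n + t − t₀)), where α* is a dual maximizer and the expectation is over the i.i.d. uniformly random indices used by the algorithm. -/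

import Mathlib

/-- Hölder inequality for a norm and its dual norm. -/
lemma ps_holder {m : ℕ} (N ND : (Fin m → ℝ) → ℝ)
    (h0 : ∀ x, 0 ≤ N x) (hz : ∀ x, N x = 0 ↔ x = 0)
    (hs : ∀ (c : ℝ) (x : Fin m → ℝ), N (c • x) = |c| * N x)
    (hD : ∀ z, IsLUB {r : ℝ | ∃ x : Fin m → ℝ, N x = 1 ∧ r = ∑ j, z j * x j} (ND z))
    (z x : Fin m → ℝ) : z ⬝ᵥ x ≤ ND z * N x := by
  by_cases hx : N x = 0
  · rw [hx, (hz x).1 hx]; simp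
  · have hpos : 0 < N x := lt_of_le_of_ne (h0 x) (Ne.symm hx)
    have h1 : z ⬝ᵥ ((N x)⁻¹ • x) ≤ ND z := by
      apply (hD z).1
      refine ⟨(N x)⁻¹ • x, ?_, rfl⟩
      rw [hs, abs_of_pos (inv_pos.2 hpos), inv_mul_cancel₀ hx]
    rw [dotProduct_smul, smul_eq_mul] at h1
    rw [inv_mul_le_iff₀ hpos] at h1
    linarith

lemma ps_dual_nonneg {m : ℕ} (N ND : (Fin m → ℝ) → ℝ)
    (hs : ∀ (c : ℝ) (x : Fin m → ℝ), N (c • x) = |c| * N x)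
    (hD : ∀ z, IsLUB {r : ℝ | ∃ x : Fin m → ℝ, N x = 1 ∧ r = ∑ j, z j * x j} (ND z))
    (z : Fin m → ℝ) : 0 ≤ ND z := by
  obtain ⟨r, x, hx, -⟩ := (hD z).nonempty
  have h1 : z ⬝ᵥ x ≤ ND z := (hD z).1 ⟨x, hx, rfl⟩
  have h2 : z ⬝ᵥ (-x) ≤ ND z := by
    refine (hD z).1 ⟨-x, ?_, rfl⟩
    have := hs (-1) x
    simp only [neg_smul, one_smul, abs_neg, abs_one, one_mul] at this
    rw [this, hx]
  rw [dotProduct_neg] at h2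
  linarith

/-- If `z` is a point where the conjugate of an `L`-Lipschitz function is finite,
its dual norm is at most `L`. -/
lemma ps_dual_le {m : ℕ} (N ND : (Fin m → ℝ) → ℝ)
    (hs : ∀ (c : ℝ) (x : Fin m → ℝ), N (c • x) = |c| * N x)
    (hD : ∀ z, IsLUB {r : ℝ | ∃ x : Fin m → ℝ, N x = 1 ∧ r = ∑ j, z j * x j} (ND z))
    (f : (Fin m → ℝ) → ℝ) (L : ℝ) (hf : ∀ a b, |f a - f b| ≤ L * N (a - b))
    (z : Fin m → ℝ) (c : ℝ) (hc : ∀ x, x ⬝ᵥ z - f x ≤ c) : ND z ≤ L := by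
  refine (hD z).2 ?_
  rintro r ⟨x, hx, rfl⟩
  change z ⬝ᵥ x ≤ L
  by_contra hlt
  push Not at hlt
  set δ := z ⬝ᵥ x - L with hδ
  have hδ0 : 0 < δ := by linarith
  set M := (|c| + |f 0| + 1) / δ with hM
  have hM0 : 0 ≤ M := by positivity
  have h1 := hc (M • x)
  have h2 := hf (M • x) 0
  rw [sub_zero, hs, abs_of_nonneg hM0, hx, mul_one] at h2
  have h3 := (abs_le.1 h2).2
  rw [smul_dotProduct, smul_eq_mul, dotProduct_comm] at h1
  have h4 : M * δ = |c| + |f 0| + 1 := by rw [hM]; field_simp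
  have h5 : M * δ = M * (z ⬝ᵥ x) - L * M := by rw [hδ]; ring
  have := le_abs_self c
  have := le_abs_self (f 0)
  linarith

/-- The bound `‖u - a‖_D ≤ 2 L`. -/
lemma ps_dual_sub {m : ℕ} (N ND : (Fin m → ℝ) → ℝ)
    (hs : ∀ (c : ℝ) (x : Fin m → ℝ), N (c • x) = |c| * N x)
    (hD : ∀ z, IsLUB {r : ℝ | ∃ x : Fin m → ℝ, N x = 1 ∧ r = ∑ j, z j * x j} (ND z))
    (y z : Fin m → ℝ) : ND (y - z) ≤ ND y + ND z := by
  refine (hD _).2 ?_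
  rintro r ⟨x, hx, rfl⟩
  change (y - z) ⬝ᵥ x ≤ _
  have h1 : y ⬝ᵥ x ≤ ND y := (hD y).1 ⟨x, hx, rfl⟩
  have h2 : z ⬝ᵥ (-x) ≤ ND z := by
    refine (hD z).1 ⟨-x, ?_, rfl⟩
    have := hs (-1) x
    simp only [neg_smul, one_smul, abs_neg, abs_one, one_mul] at this
    rw [this, hx]
  rw [dotProduct_neg] at h2
  rw [sub_dotProduct]
  linarith

lemma ps_dual_smul {m : ℕ} (N ND : (Fin m → ℝ) → ℝ)
    (hD : ∀ z, IsLUB {r : ℝ | ∃ x : Fin m → ℝ, N x = 1 ∧ r = ∑ j, z j * x j} (ND z))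
    (s : ℝ) (h : 0 ≤ s) (y : Fin m → ℝ) : ND (s • y) ≤ s * ND y := by
  refine (hD _).2 ?_
  rintro r ⟨x, hx, rfl⟩
  change (s • y) ⬝ᵥ x ≤ _
  rw [smul_dotProduct, smul_eq_mul]
  exact mul_le_mul_of_nonneg_left ((hD y).1 ⟨x, hx, rfl⟩) h

/-- Existence of subgradients. -/
lemma ps_subgrad {m : ℕ} (f : (Fin m → ℝ) → ℝ) (hf : ConvexOn ℝ Set.univ f) (a : Fin m → ℝ) :
    ∃ z : Fin m → ℝ, ∀ y, y ⬝ᵥ z - f y ≤ a ⬝ᵥ z - f a := by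
  have hcont : Continuous f := hf.locallyLipschitz.continuous
  have hconv := hf.convex_strict_epigraph
  have hopen : IsOpen {p : (Fin m → ℝ) × ℝ | p.1 ∈ Set.univ ∧ f p.1 < p.2} := by
    simp only [Set.mem_univ, true_and]
    exact isOpen_lt (hcont.comp continuous_fst) continuous_snd
  obtain ⟨F, hF⟩ := geometric_hahn_banach_point_open hconv hopen
    (x := (a, f a)) (by simp)
  set c := F (0, 1) with hc
  have hsplit : ∀ (y : Fin m → ℝ) (r : ℝ), F (y, r) = F (y, 0) + r * c := by
    intro y r
    have : (y, r) = (y, (0:ℝ)) + r • ((0 : Fin m → ℝ), (1:ℝ)) := by simp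
    rw [this, map_add, map_smul, smul_eq_mul]
  have hcpos : 0 < c := by
    have := hF (a, f a + 1) (by simp)
    rw [hsplit a (f a), hsplit a (f a + 1)] at this
    linarith
  have hy : ∀ y, F (a, 0) + f a * c ≤ F (y, 0) + f y * c := by
    intro y
    apply le_of_forall_pos_le_add
    intro ε hε
    have := hF (y, f y + ε / c) (by simp; positivity)
    rw [hsplit a (f a), hsplit y (f y + ε / c)] at this
    have h2 : ε / c * c = ε := by field_simp
    nlinarith
  have hlin : ∀ y : Fin m → ℝ, F (y, 0) = y ⬝ᵥ fun j => F (Pi.single j 1, 0) := by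
    intro y
    have h1 := LinearMap.pi_apply_eq_sum_univ
      ((F : ((Fin m → ℝ) × ℝ) →ₗ[ℝ] ℝ).comp (LinearMap.inl ℝ (Fin m → ℝ) ℝ)) y
    simp only [LinearMap.comp_apply, LinearMap.inl_apply, smul_eq_mul] at h1
    simp only [dotProduct]
    refine Eq.trans h1 ?_
    refine Finset.sum_congr rfl fun j _ => ?_
    have : (fun l => if j = l then (1:ℝ) else 0) = Pi.single j 1 := by
      ext l
      simp [Pi.single_apply, eq_comm]
    rw [this]
    rfl
  refine ⟨fun j => -(F (Pi.single j 1, 0)) / c, fun y => ?_⟩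
  have hdot : ∀ y : Fin m → ℝ, (y ⬝ᵥ fun j => -(F (Pi.single j 1, 0)) / c) = - F (y, 0) / c := by
    intro y
    rw [hlin]
    simp only [dotProduct, ← Finset.sum_neg_distrib, Finset.sum_div]
    refine Finset.sum_congr rfl fun j _ => ?_
    ring
  rw [hdot, hdot]
  have := hy y
  have e1 : -F (y, 0) / c - f y = -(F (y, 0) + f y * c) / c := by field_simp; ring
  have e2 : -F (a, 0) / c - f a = -(F (a, 0) + f a * c) / c := by field_simp; ring
  rw [e1, e2]
  gcongr

/-- Smoothness of the conjugate of a strongly convex function. -/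
lemma ps_smooth {d : ℕ} (N ND : (Fin d → ℝ) → ℝ)
    (h0 : ∀ x, 0 ≤ N x) (hz : ∀ x, N x = 0 ↔ x = 0)
    (hs : ∀ (c : ℝ) (x : Fin d → ℝ), N (c • x) = |c| * N x)
    (hD : ∀ z, IsLUB {r : ℝ | ∃ x : Fin d → ℝ, N x = 1 ∧ r = ∑ j, z j * x j} (ND z))
    (g : (Fin d → ℝ) → ℝ)
    (hgsc : ∀ (w₁ w₂ : Fin d → ℝ) (t : ℝ), 0 ≤ t → t ≤ 1 →
      g (t • w₁ + (1 - t) • w₂) ≤ t * g w₁ + (1 - t) * g w₂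
        - (t * (1 - t) / 2) * N (w₁ - w₂) ^ 2)
    (G : (Fin d → ℝ) → (Fin d → ℝ))
    (hG : ∀ (v w' : Fin d → ℝ), w' ⬝ᵥ v - g w' ≤ G v ⬝ᵥ v - g (G v))
    (v u : Fin d → ℝ) :
    G (v + u) ⬝ᵥ (v + u) - g (G (v + u)) ≤
      G v ⬝ᵥ v - g (G v) + G v ⬝ᵥ u + ND u ^ 2 / 2 := by
  set w := G v with hw
  set w' := G (v + u) with hw'
  have key : g w + (w' - w) ⬝ᵥ v + N (w' - w) ^ 2 / 2 ≤ g w' := by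
    -- for every t in (0,1]
    have ht : ∀ t : ℝ, 0 < t → t ≤ 1 →
        g w + (w' - w) ⬝ᵥ v + (1 - t) * (N (w' - w) ^ 2 / 2) ≤ g w' := by
      intro t ht0 ht1
      have h1 := hgsc w' w t ht0.le ht1
      have h2 := hG v (t • w' + (1 - t) • w)
      rw [← hw] at h2
      simp only [add_dotProduct, smul_dotProduct, smul_eq_mul] at h2
      rw [sub_dotProduct]
      refine le_of_mul_le_mul_left ?_ ht0
      nlinarith
    apply le_of_forall_pos_le_add
    intro ε hε
    set B := N (w' - w) ^ 2 / 2 with hB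
    have hB0 : 0 ≤ B := by positivity
    have h3 := ht (min 1 (ε / (B + 1))) (by positivity) (min_le_left _ _)
    have h4 : min 1 (ε / (B + 1)) * B ≤ ε := by
      calc min 1 (ε / (B + 1)) * B ≤ ε / (B + 1) * B := by gcongr; exact min_le_right _ _
        _ = ε * (B / (B + 1)) := by ring
        _ ≤ ε * 1 := by
            gcongr
            rw [div_le_one (by positivity)]; linarith
        _ = ε := mul_one _
    nlinarith
  have h5 := ps_holder N ND h0 hz hs hD u (w' - w)
  rw [dotProduct_sub, dotProduct_comm u w', dotProduct_comm u w] at h5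
  rw [sub_dotProduct] at key
  rw [dotProduct_add]
  nlinarith [sq_nonneg (ND u - N (w' - w))]

/-- One coordinate step of Prox-SDCA. -/
lemma ps_one_step {k d : ℕ} (R L κ : ℝ) (hR : 0 < R) (hκ : 0 ≤ κ)
    (NP ND : (Fin k → ℝ) → ℝ)
    (hs : ∀ (c : ℝ) (x : Fin k → ℝ), NP (c • x) = |c| * NP x)
    (hD : ∀ z, IsLUB {r : ℝ | ∃ x : Fin k → ℝ, NP x = 1 ∧ r = ∑ j, z j * x j} (ND z))
    (ND' : (Fin d → ℝ) → ℝ) (hND' : ∀ z, 0 ≤ ND' z)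
    (X : Matrix (Fin d) (Fin k) ℝ)
    (hXR : ∀ z : Fin k → ℝ, ND' (X.mulVec z) ≤ R * ND z)
    (f : (Fin k → ℝ) → ℝ) (hfc : ConvexOn ℝ Set.univ f)
    (hf : ∀ a b, |f a - f b| ≤ L * NP (a - b))
    (F : (Fin k → ℝ) → EReal)
    (hF : ∀ z, F z = ⨆ x : Fin k → ℝ, ((x ⬝ᵥ z - f x : ℝ) : EReal))
    (w : Fin d → ℝ) (a Δ : Fin k → ℝ) (c : ℝ) (hc : F (-a) = (c : EReal))
    (hmax : ∀ Δ' : Fin k → ℝ,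
      -(F (-(a + Δ'))) - ((w ⬝ᵥ X.mulVec Δ' + κ * ND' (X.mulVec Δ') ^ 2 : ℝ) : EReal) ≤
      -(F (-(a + Δ))) - ((w ⬝ᵥ X.mulVec Δ + κ * ND' (X.mulVec Δ) ^ 2 : ℝ) : EReal)) :
    ∃ c' : ℝ, F (-(a + Δ)) = (c' : EReal) ∧ ∀ s : ℝ, 0 ≤ s → s ≤ 1 →
      -c + s * (f (X.transpose.mulVec w) + c + w ⬝ᵥ X.mulVec a) - s ^ 2 * (κ * (2 * R * L) ^ 2) ≤
        -c' - (w ⬝ᵥ X.mulVec Δ + κ * ND' (X.mulVec Δ) ^ 2) := by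
  have hle : ∀ z (r : ℝ), F z ≤ (r : EReal) ↔ ∀ x, x ⬝ᵥ z - f x ≤ r := by
    intro z r
    rw [hF, iSup_le_iff]
    simp only [EReal.coe_le_coe_iff]
  have hbot : ∀ z, F z ≠ ⊥ := by
    intro z hz
    rw [hF, iSup_eq_bot] at hz
    exact EReal.coe_ne_bot _ (hz 0)
  have htop : F (-(a + Δ)) ≠ ⊤ := by
    intro h
    have h1 := hmax 0
    rw [h, add_zero, hc, EReal.neg_top, EReal.bot_sub, le_bot_iff] at h1
    rw [← EReal.coe_neg, ← EReal.coe_sub] at h1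
    exact EReal.coe_ne_bot _ h1
  obtain ⟨c', hc'⟩ : ∃ c' : ℝ, F (-(a + Δ)) = (c' : EReal) :=
    ⟨_, (EReal.coe_toReal htop (hbot _)).symm⟩
  refine ⟨c', hc', fun s hs0 hs1 => ?_⟩
  set b := X.transpose.mulVec w with hb
  have hbX : ∀ y, w ⬝ᵥ X.mulVec y = b ⬝ᵥ y := by
    intro y
    rw [hb, Matrix.mulVec_transpose, Matrix.dotProduct_mulVec]
  obtain ⟨z, hz⟩ := ps_subgrad f hfc b
  have hca : ∀ x, x ⬝ᵥ (-a) - f x ≤ c := (hle _ _).1 hc.le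
  have hNz : ND z ≤ L := ps_dual_le NP ND hs hD f L hf z _ hz
  have hNa : ND (-a) ≤ L := ps_dual_le NP ND hs hD f L hf (-a) _ hca
  have hNaz : ND (-a - z) ≤ 2 * L := by
    have := ps_dual_sub NP ND hs hD (-a) z
    linarith
  set Δs : Fin k → ℝ := s • (-a - z) with hΔs
  have hr : F (-(a + Δs)) ≤ (((1 - s) * c + s * (b ⬝ᵥ z - f b) : ℝ) : EReal) := by
    rw [hle]
    intro x
    have e : -(a + Δs) = (1 - s) • (-a) + s • z := by
      rw [hΔs]; module
    rw [e, dotProduct_add, dotProduct_smul, dotProduct_smul, smul_eq_mul, smul_eq_mul]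
    have h1 := mul_le_mul_of_nonneg_left (hca x) (sub_nonneg.2 hs1)
    have h2 := mul_le_mul_of_nonneg_left (hz x) hs0
    linarith
  have hm : -((1 - s) * c + s * (b ⬝ᵥ z - f b)) - (w ⬝ᵥ X.mulVec Δs + κ * ND' (X.mulVec Δs) ^ 2)
      ≤ -c' - (w ⬝ᵥ X.mulVec Δ + κ * ND' (X.mulVec Δ) ^ 2) := by
    have h1 := hmax Δs
    rw [hc'] at h1
    have h2 := (EReal.sub_le_sub (EReal.neg_le_neg_iff.2 hr) (le_refl
      ((w ⬝ᵥ X.mulVec Δs + κ * ND' (X.mulVec Δs) ^ 2 : ℝ) : EReal))).trans h1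
    exact_mod_cast h2
  have hN : ND' (X.mulVec Δs) ≤ s * (2 * R * L) := by
    calc ND' (X.mulVec Δs) ≤ R * ND Δs := hXR _
      _ ≤ R * (s * ND (-a - z)) := by
          gcongr; exact ps_dual_smul NP ND hD s hs0 _
      _ ≤ R * (s * (2 * L)) := by gcongr
      _ = _ := by ring
  have hN2 : κ * ND' (X.mulVec Δs) ^ 2 ≤ κ * (s * (2 * R * L)) ^ 2 := by
    have := hND' (X.mulVec Δs)
    gcongr
  have hw : w ⬝ᵥ X.mulVec Δs = s * (- (b ⬝ᵥ a) - b ⬝ᵥ z) := by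
    rw [hbX, hΔs, dotProduct_smul, dotProduct_sub, dotProduct_neg, smul_eq_mul]
  rw [hw] at hm
  rw [hbX a]
  nlinarith

/-- Extension of a finite sequence of indices by a default value. -/
def psExt {n : ℕ} (hn : 0 < n) (T : ℕ) (σ : Fin T → Fin n) : ℕ → Fin n :=
  fun s => if h : s < T then σ ⟨s, h⟩ else ⟨0, hn⟩

/-- Average over all index sequences of length `T`. -/
noncomputable def psAvg {n : ℕ} (hn : 0 < n) (T : ℕ) (F : (ℕ → Fin n) → ℝ) : ℝ :=
  (1 / (n : ℝ) ^ T) * ∑ σ : Fin T → Fin n, F (psExt hn T σ)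

lemma psExt_snoc {n : ℕ} (hn : 0 < n) (T : ℕ) (σ : Fin T → Fin n) (i : Fin n) :
    psExt hn (T + 1) (Fin.snoc (α := fun _ => Fin n) σ i) =
      Function.update (psExt hn T σ) T i := by
  ext s
  by_cases h1 : s = T
  · subst h1
    simp [psExt, Fin.snoc]
  · rw [Function.update_of_ne h1]
    by_cases h2 : s < T
    · have h3 : s < T + 1 := by omega
      simp [psExt, Fin.snoc, h2, h3]
    · have h3 : ¬ s < T + 1 := by omega
      simp [psExt, h2, h3]

lemma psAvg_succ {n : ℕ} (hn : 0 < n) (T : ℕ) (F : (ℕ → Fin n) → ℝ) :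
    psAvg hn (T + 1) F =
      psAvg hn T (fun ω => (1 / (n : ℝ)) * ∑ i, F (Function.update ω T i)) := by
  unfold psAvg
  rw [← Equiv.sum_comp (Fin.snocEquiv (fun _ => Fin n)), Fintype.sum_prod_type_right,
    ← Finset.mul_sum, ← mul_assoc]
  congr 1
  · rw [pow_succ]; field_simp
  · refine Finset.sum_congr rfl fun σ _ => Finset.sum_congr rfl fun i _ => ?_
    rw [← psExt_snoc]
    rfl

lemma psAvg_mono {n : ℕ} (hn : 0 < n) (T : ℕ) {F G : (ℕ → Fin n) → ℝ} (h : ∀ ω, F ω ≤ G ω) :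
    psAvg hn T F ≤ psAvg hn T G := by
  unfold psAvg
  gcongr
  exact h _

lemma psAvg_const {n : ℕ} (hn : 0 < n) (T : ℕ) (c : ℝ) : psAvg hn T (fun _ => c) = c := by
  unfold psAvg
  have : (n : ℝ) ≠ 0 := by positivity
  simp
  field_simp

lemma psAvg_add {n : ℕ} (hn : 0 < n) (T : ℕ) (F G : (ℕ → Fin n) → ℝ) :
    psAvg hn T (fun ω => F ω + G ω) = psAvg hn T F + psAvg hn T G := by
  unfold psAvg
  rw [Finset.sum_add_distrib, mul_add]

lemma psAvg_mul {n : ℕ} (hn : 0 < n) (T : ℕ) (c : ℝ) (F : (ℕ → Fin n) → ℝ) :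
    psAvg hn T (fun ω => c * F ω) = c * psAvg hn T F := by
  unfold psAvg
  rw [← Finset.mul_sum]; ring

lemma psAvg_sum {n : ℕ} (hn : 0 < n) (T : ℕ) (S : Finset ℕ) (F : ℕ → (ℕ → Fin n) → ℝ) :
    psAvg hn T (fun ω => ∑ t ∈ S, F t ω) = ∑ t ∈ S, psAvg hn T (F t) := by
  unfold psAvg
  rw [Finset.sum_comm, Finset.mul_sum]

lemma psAvg_stable {n : ℕ} (hn : 0 < n) (t T : ℕ) (h : t ≤ T) (F : (ℕ → Fin n) → ℝ)
    (hF : ∀ ω ω', (∀ s < t, ω s = ω' s) → F ω = F ω') :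
    psAvg hn T F = psAvg hn t F := by
  induction T, h using Nat.le_induction with
  | base => rfl
  | succ T hT ih =>
    rw [psAvg_succ, ← ih]
    congr 1
    ext ω
    have h1 : ∀ i, F (Function.update ω T i) = F ω := fun i =>
      hF _ _ fun s hs => Function.update_of_ne (by omega) _ _
    have : (n : ℝ) ≠ 0 := by positivity
    simp [h1]
    field_simp

/-- The scalar recursion. `A = (RL)²`. -/
lemma ps_rec (n : ℕ) (hn : 0 < n) (lam A : ℝ) (hlam : 0 < lam) (hA : 0 < A)
    (e γ : ℕ → ℝ) (he0 : e 0 ≤ 1) (heγ : ∀ t, e t ≤ γ t)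
    (hstep : ∀ t (s : ℝ), 0 ≤ s → s ≤ 1 →
      e (t + 1) ≤ e t - s / n * γ t + (s / n) ^ 2 * (2 * A / lam))
    (t₀ : ℕ) (ht₀ : t₀ = (⌈(n : ℝ) * Real.log (lam * n / (2 * A))⌉).toNat) :
    ∀ t, t₀ ≤ t → e t ≤ 8 * A / (lam * (2 * (n : ℝ) + (t : ℝ) - (t₀ : ℝ))) := by
  have hn1 : (1 : ℝ) ≤ n := by exact_mod_cast hn
  have hn0 : (0 : ℝ) < n := by linarith
  -- contraction with s = 1
  have h1 : ∀ t : ℕ, e t ≤ Real.exp (-(t : ℝ) / n) + 2 * A / (lam * n) := by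
    have hq0 : 0 ≤ 1 - 1 / (n : ℝ) := by
      rw [sub_nonneg, div_le_one hn0]; exact hn1
    have hexp : 1 - 1 / (n : ℝ) ≤ Real.exp (-1 / n) := by
      have := Real.add_one_le_exp (-1 / (n : ℝ))
      have e1 : -1 / (n : ℝ) + 1 = 1 - 1 / n := by ring
      linarith
    intro t
    induction t with
    | zero =>
      simp only [Nat.cast_zero, neg_zero, zero_div, Real.exp_zero]
      have : 0 ≤ 2 * A / (lam * n) := by positivity
      linarith
    | succ t ih =>
      have h2 := hstep t 1 zero_le_one le_rfl
      have h3 : 1 / (n : ℝ) * e t ≤ 1 / (n : ℝ) * γ t := by gcongr; exact heγ t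
      have h4 : (1 - 1 / (n : ℝ)) * e t ≤
          (1 - 1 / (n : ℝ)) * (Real.exp (-(t : ℝ) / n) + 2 * A / (lam * n)) := by gcongr
      have h5 : (1 - 1 / (n : ℝ)) * Real.exp (-(t : ℝ) / n) ≤
          Real.exp (-((t + 1 : ℕ) : ℝ) / n) := by
        have : -((t + 1 : ℕ) : ℝ) / n = -1 / n + -(t : ℝ) / n := by push_cast; ring
        rw [this, Real.exp_add]
        gcongr
      have h6 : (1 - 1 / (n : ℝ)) * (2 * A / (lam * n)) + (1 / (n : ℝ)) ^ 2 * (2 * A / lam)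
          = 2 * A / (lam * n) := by field_simp; ring
      nlinarith
  intro t ht
  induction t, ht using Nat.le_induction with
  | base =>
    have h2 : (n : ℝ) * Real.log (lam * n / (2 * A)) ≤ t₀ := by
      have h3 := Int.le_ceil ((n : ℝ) * Real.log (lam * n / (2 * A)))
      have h4 : (⌈(n : ℝ) * Real.log (lam * n / (2 * A))⌉) ≤ (t₀ : ℤ) := by
        rw [ht₀]; exact Int.self_le_toNat _
      have h5 : ((⌈(n : ℝ) * Real.log (lam * n / (2 * A))⌉ : ℤ) : ℝ) ≤ (t₀ : ℝ) := by
        exact_mod_cast h4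
      linarith
    have h3 : Real.exp (-(t₀ : ℝ) / n) ≤ 2 * A / (lam * n) := by
      have hpos : 0 < 2 * A / (lam * n) := by positivity
      rw [← Real.le_log_iff_exp_le hpos]
      have : Real.log (2 * A / (lam * n)) = - Real.log (lam * n / (2 * A)) := by
        rw [← Real.log_inv, inv_div]
      rw [this, neg_div, neg_le_neg_iff, le_div_iff₀ hn0]
      linarith
    have h4 := h1 t₀
    have h5 : 8 * A / (lam * (2 * (n : ℝ) + (t₀ : ℝ) - (t₀ : ℝ))) =
      2 * A / (lam * n) + 2 * A / (lam * n) := by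
      rw [add_sub_cancel_right]; field_simp; ring
    linarith
  | succ t ht ih =>
    have htr : (t₀ : ℝ) ≤ t := by exact_mod_cast ht
    set m : ℝ := 2 * n + t - t₀ with hm
    have hm2 : 2 * (n : ℝ) ≤ m := by linarith
    have hm0 : 0 < m := by linarith
    have h2 := hstep t (2 * n / m) (by positivity) (by rw [div_le_one hm0]; exact hm2)
    have e1 : 2 * (n : ℝ) / m / n = 2 / m := by field_simp
    rw [e1] at h2
    have h3 : 2 / m * e t ≤ 2 / m * γ t := by gcongr; exact heγ t
    have hq : 0 ≤ 1 - 2 / m := by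
      rw [sub_nonneg, div_le_one hm0]; linarith
    have h4 : (1 - 2 / m) * e t ≤ (1 - 2 / m) * (8 * A / (lam * m)) := by gcongr
    have h5 : 2 * (n : ℝ) + ((t + 1 : ℕ) : ℝ) - t₀ = m + 1 := by push_cast; rw [hm]; ring
    rw [h5]
    have h6 : (1 - 2 / m) * (8 * A / (lam * m)) + (2 / m) ^ 2 * (2 * A / lam) ≤
        8 * A / (lam * (m + 1)) := by
      have : (1 - 2 / m) * (8 * A / (lam * m)) + (2 / m) ^ 2 * (2 * A / lam) =
        8 * A / lam * ((m - 1) / m ^ 2) := by field_simp; ring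
      rw [this]
      have e2 : 8 * A / (lam * (m + 1)) = 8 * A / lam * (1 / (m + 1)) := by field_simp
      rw [e2]
      refine mul_le_mul_of_nonneg_left ?_ (by positivity)
      rw [div_le_div_iff₀ (by positivity) (by positivity)]
      nlinarith
    nlinarith

/-- The averaged gap. -/
lemma ps_gap (n : ℕ) (hn : 0 < n) (lam A εP : ℝ) (hlam : 0 < lam) (hA : 0 < A) (hε : 0 < εP)
    (e γ : ℕ → ℝ) (he : ∀ t, 0 ≤ e t)
    (hstep : ∀ t (s : ℝ), 0 ≤ s → s ≤ 1 →
      e (t + 1) ≤ e t - s / n * γ t + (s / n) ^ 2 * (2 * A / lam))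
    (t₀ T₀ T : ℕ)
    (hT₀ : max ((t₀ : ℝ)) ((t₀ : ℝ) + 16 * A / (lam * εP) - 2 * (n : ℝ)) ≤ (T₀ : ℝ))
    (hT : (T₀ : ℝ) + max ((n : ℝ)) (4 * A / (lam * εP)) ≤ (T : ℝ))
    (heT : e T₀ ≤ 8 * A / (lam * (2 * (n : ℝ) + (T₀ : ℝ) - (t₀ : ℝ)))) :
    (1 / ((T : ℝ) - T₀)) * ∑ t ∈ Finset.Icc (T₀ + 1) T, γ (t - 1) ≤ εP := by
  have hn1 : (1 : ℝ) ≤ n := by exact_mod_cast hn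
  have hn0 : (0 : ℝ) < n := by linarith
  have hTn : (n : ℝ) ≤ T - T₀ := by linarith [le_max_left (n : ℝ) (4 * A / (lam * εP))]
  have hTA : 4 * A / (lam * εP) ≤ T - T₀ := by linarith [le_max_right (n : ℝ) (4 * A / (lam * εP))]
  have hT1 : (t₀ : ℝ) ≤ T₀ := (le_max_left _ _).trans hT₀
  have hT2 : 16 * A / (lam * εP) ≤ 2 * n + T₀ - t₀ := by
    linarith [(le_max_right _ _).trans hT₀]
  set K : ℝ := T - T₀ with hK
  have hK0 : 0 < K := by linarith
  have hst : ∀ t, 1 / K * γ t ≤ e t - e (t + 1) + (1 / K) ^ 2 * (2 * A / lam) := by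
    intro t
    have h2 := hstep t (n / K) (by positivity) (by rw [div_le_one hK0]; exact hTn)
    have e1 : (n : ℝ) / K / n = 1 / K := by field_simp
    rw [e1] at h2
    linarith
  have hle : T₀ ≤ T := by
    have : (T₀ : ℝ) ≤ T := by linarith
    exact_mod_cast this
  have hsum : ∀ T', T₀ ≤ T' → 1 / K * ∑ t ∈ Finset.Icc (T₀ + 1) T', γ (t - 1) ≤
      e T₀ - e T' + ((T' : ℝ) - T₀) * ((1 / K) ^ 2 * (2 * A / lam)) := by
    intro T' hT'
    induction T', hT' using Nat.le_induction with
    | base => simp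
    | succ t ht ih =>
      rw [Finset.sum_Icc_succ_top (by omega), mul_add]
      have := hst t
      simp only [Nat.add_sub_cancel]
      push_cast
      linarith
  have h3 := hsum T hle
  rw [← hK] at h3
  have h4 : K * ((1 / K) ^ 2 * (2 * A / lam)) = 2 * A / (lam * K) := by field_simp
  rw [h4] at h3
  have h5 : 2 * A / (lam * K) ≤ εP / 2 := by
    rw [div_le_iff₀ (by positivity)] at hTA
    rw [div_le_iff₀ (by positivity)]
    nlinarith
  have h6 : 8 * A / (lam * (2 * (n : ℝ) + (T₀ : ℝ) - (t₀ : ℝ))) ≤ εP / 2 := by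
    have : 0 < 2 * (n : ℝ) + (T₀ : ℝ) - (t₀ : ℝ) := by linarith
    rw [div_le_iff₀ (by positivity)] at hT2
    rw [div_le_iff₀ (by positivity)]
    nlinarith
  have := he T
  linarith

lemma ps_coe_sum {ι : Type*} (S : Finset ι) (f : ι → ℝ) :
    ((∑ i ∈ S, f i : ℝ) : EReal) = ∑ i ∈ S, ((f i : ℝ) : EReal) := by
  classical
  induction S using Finset.induction_on with
  | empty => simp
  | insert a S ha ih => rw [Finset.sum_insert ha, Finset.sum_insert ha, EReal.coe_add, ih]


/-- Theorem 2: for L-Lipschitz losses, Prox-SDCA with Option I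
updates satisfies: (i) the expected average duality gap over iterations
`T₀+1,…,T` is at most `ε_P`, provided
`t₀ = max(0, ⌈n log(λn/(2(RL)²))⌉)`, `T₀ ≥ max(t₀, t₀ + 16(RL)²/(λε_P) − 2n)` and
`T ≥ T₀ + max(n, 4(RL)²/(λε_P))`; and (ii) for every `t ≥ t₀` the expected dual
sub-optimality satisfies `E[D(α*) − D(α^(t))] ≤ 8(RL)²/(λ(2n + t − t₀))`.
The expectation is the average over all sequences of the i.i.d. uniform
coordinate indices. -/
theorem prox_sdca_lipschitz (d k n : ℕ) (hn : 0 < n)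
    (lam L R εP : ℝ) (hlam : 0 < lam) (hL : 0 < L) (hR : 0 < R) (hεP : 0 < εP)
    -- ‖·‖_P, a norm on ℝ^k, and its dual norm ‖·‖_D:
    (NP : (Fin k → ℝ) → ℝ)
    (hNP_nonneg : ∀ x, 0 ≤ NP x)
    (hNP_eq_zero : ∀ x, NP x = 0 ↔ x = 0)
    (hNP_add : ∀ x y, NP (x + y) ≤ NP x + NP y)
    (hNP_smul : ∀ (c : ℝ) (x : Fin k → ℝ), NP (c • x) = |c| * NP x)
    (ND : (Fin k → ℝ) → ℝ)
    (hND : ∀ z, IsLUB {r : ℝ | ∃ x : Fin k → ℝ, NP x = 1 ∧ r = ∑ j, z j * x j} (ND z))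
    -- ‖·‖_{P'}, a norm on ℝ^d, and its dual norm ‖·‖_{D'}:
    (NP' : (Fin d → ℝ) → ℝ)
    (hNP'_nonneg : ∀ x, 0 ≤ NP' x)
    (hNP'_eq_zero : ∀ x, NP' x = 0 ↔ x = 0)
    (hNP'_add : ∀ x y, NP' (x + y) ≤ NP' x + NP' y)
    (hNP'_smul : ∀ (c : ℝ) (x : Fin d → ℝ), NP' (c • x) = |c| * NP' x)
    (ND' : (Fin d → ℝ) → ℝ)
    (hND' : ∀ z, IsLUB {r : ℝ | ∃ x : Fin d → ℝ, NP' x = 1 ∧ r = ∑ j, z j * x j} (ND' z))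
    -- data matrices, with operator norms bounded by R:
    (X : Fin n → Matrix (Fin d) (Fin k) ℝ)
    (hXR : ∀ i (z : Fin k → ℝ), ND' ((X i).mulVec z) ≤ R * ND z)
    -- the losses: convex, nonnegative, L-Lipschitz w.r.t. ‖·‖_P, small at 0:
    (φ : Fin n → (Fin k → ℝ) → ℝ) (hφconv : ∀ i, ConvexOn ℝ Set.univ (φ i))
    (hφlip : ∀ i a b, |φ i a - φ i b| ≤ L * NP (a - b))
    (hφnonneg : ∀ i a, 0 ≤ φ i a)
    (hφzero : (1 / n) * ∑ i, φ i 0 ≤ 1)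
    -- the regularizer: convex, 1-strongly convex w.r.t. ‖·‖_{P'}, normalized:
    (g : (Fin d → ℝ) → ℝ) (hgconv : ConvexOn ℝ Set.univ g)
    (hgsc : ∀ (w₁ w₂ : Fin d → ℝ) (t : ℝ), 0 ≤ t → t ≤ 1 →
      g (t • w₁ + (1 - t) • w₂) ≤ t * g w₁ + (1 - t) * g w₂
        - (t * (1 - t) / 2) * NP' (w₁ - w₂) ^ 2)
    (hgzero : g 0 = 0) (hgnonneg : ∀ w, 0 ≤ g w)
    -- conjugates of the losses:
    (fconj : Fin n → (Fin k → ℝ) → EReal)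
    (hfconj : ∀ i z, fconj i z = ⨆ x : Fin k → ℝ, ((∑ j, x j * z j - φ i x : ℝ) : EReal))
    -- `Ggrad v = ∇g*(v)`, the maximizer of `w ↦ wᵀv − g(w)` (so that
    -- `g*(v) = Ggrad v ᵀ v − g (Ggrad v)`):
    (Ggrad : (Fin d → ℝ) → (Fin d → ℝ))
    (hGgrad : ∀ (v w' : Fin d → ℝ),
      (∑ j, w' j * v j) - g w' ≤ (∑ j, Ggrad v j * v j) - g (Ggrad v))
    -- primal and dual objectives:
    (vmap : (Fin n → Fin k → ℝ) → (Fin d → ℝ))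
    (hvmap : ∀ β, vmap β = (1 / (lam * n)) • ∑ i, (X i).mulVec (β i))
    (P : (Fin d → ℝ) → ℝ)
    (hP : ∀ w, P w = (1 / n) * ∑ i, φ i ((X i).transpose.mulVec w) + lam * g w)
    (D : (Fin n → Fin k → ℝ) → EReal)
    (hD : ∀ β, D β = ((1 / n : ℝ) : EReal) * (∑ i, -(fconj i (-(β i))))
        - ((lam * ((∑ j, Ggrad (vmap β) j * vmap β j) - g (Ggrad (vmap β))) : ℝ) : EReal))
    -- the Prox-SDCA trajectory: `αseq ω t` is the dual iterate after `t` steps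
    -- when the random coordinate indices are `ω 0, ω 1, …`:
    (αseq : (ℕ → Fin n) → ℕ → (Fin n → Fin k → ℝ))
    (hinit : ∀ ω, αseq ω 0 = 0)
    (hadapt : ∀ ω ω' t, (∀ s < t, ω s = ω' s) → αseq ω t = αseq ω' t)
    -- Option I: the increment of column `ω t` maximizes the proximal dual objective:
    (obj : (ℕ → Fin n) → ℕ → (Fin k → ℝ) → EReal)
    (hobj : ∀ ω t Δ, obj ω t Δ = -(fconj (ω t) (-(αseq ω t (ω t) + Δ)))
        - (((∑ j, Ggrad (vmap (αseq ω t)) j * (X (ω t)).mulVec Δ j)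
          + (1 / (2 * lam * n)) * ND' ((X (ω t)).mulVec Δ) ^ 2 : ℝ) : EReal))
    (hupdate : ∀ ω t, ∃ Δ : Fin k → ℝ,
      αseq ω (t + 1) = Function.update (αseq ω t) (ω t) (αseq ω t (ω t) + Δ) ∧
      ∀ Δ' : Fin k → ℝ, obj ω t Δ' ≤ obj ω t Δ)
    (t₀ : ℕ) (ht₀ : t₀ = (⌈(n : ℝ) * Real.log (lam * n / (2 * (R * L) ^ 2))⌉).toNat) :
    -- (i): expected average duality gap over iterations T₀+1,…,T is at most ε_P
    (∀ T₀ T : ℕ,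
      max ((t₀ : ℝ)) ((t₀ : ℝ) + 16 * (R * L) ^ 2 / (lam * εP) - 2 * (n : ℝ)) ≤ (T₀ : ℝ) →
      (T₀ : ℝ) + max ((n : ℝ)) (4 * (R * L) ^ 2 / (lam * εP)) ≤ (T : ℝ) →
      ((1 / (n : ℝ) ^ T : ℝ) : EReal) * ∑ σ : Fin T → Fin n,
          (((1 / ((T : ℝ) - (T₀ : ℝ)) : ℝ) : EReal) * ∑ t ∈ Finset.Icc (T₀ + 1) T,
            (((P (Ggrad (vmap (αseq (fun s => if h : s < T then σ ⟨s, h⟩ else ⟨0, hn⟩) (t - 1)))) : ℝ) : EReal)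
              - D (αseq (fun s => if h : s < T then σ ⟨s, h⟩ else ⟨0, hn⟩) (t - 1))))
        ≤ ((εP : ℝ) : EReal)) ∧
    -- (ii): expected dual sub-optimality for every t ≥ t₀
    (∀ αstar : Fin n → Fin k → ℝ, (∀ β, D β ≤ D αstar) →
      ∀ t : ℕ, t₀ ≤ t →
      ((1 / (n : ℝ) ^ t : ℝ) : EReal) * ∑ σ : Fin t → Fin n,
          (D αstar - D (αseq (fun s => if h : s < t then σ ⟨s, h⟩ else ⟨0, hn⟩) t))
        ≤ ((8 * (R * L) ^ 2 / (lam * (2 * (n : ℝ) + (t : ℝ) - (t₀ : ℝ))) : ℝ) : EReal)) := by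
  classical
  have hn1 : (1 : ℝ) ≤ n := by exact_mod_cast hn
  have hn0 : (0 : ℝ) < n := by linarith
  have hND'0 := ps_dual_nonneg NP' ND' hNP'_smul hND'
  -- real-valued conjugates
  set fr : Fin n → (Fin k → ℝ) → ℝ := fun i z => (fconj i z).toReal with hfr
  have hbot : ∀ i z, fconj i z ≠ ⊥ := by
    intro i z hz
    rw [hfconj, iSup_eq_bot] at hz
    exact EReal.coe_ne_bot _ (hz 0)
  have hfrc : ∀ i z, fconj i z ≠ ⊤ → fconj i z = ((fr i z : ℝ) : EReal) := fun i z h =>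
    (EReal.coe_toReal h (hbot i z)).symm
  have hfr_of : ∀ i z (c : ℝ), fconj i z = (c : EReal) → fr i z = c := by
    intro i z c h
    simp only [hfr]
    rw [h, EReal.toReal_coe]
  have hfle : ∀ i z (c : ℝ), fconj i z = (c : EReal) → ∀ x, x ⬝ᵥ z - φ i x ≤ c := by
    intro i z c h x
    have h1 : ((x ⬝ᵥ z - φ i x : ℝ) : EReal) ≤ (c : EReal) := by
      rw [← h, hfconj]
      exact le_iSup (fun x : Fin k → ℝ => ((∑ j, x j * z j - φ i x : ℝ) : EReal)) x
    exact_mod_cast h1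
  set gs : (Fin d → ℝ) → ℝ := fun v => Ggrad v ⬝ᵥ v - g (Ggrad v) with hgs
  set Dr : (Fin n → Fin k → ℝ) → ℝ := fun β =>
    (1 / n : ℝ) * (∑ i, -(fr i (-(β i)))) - lam * gs (vmap β) with hDr
  have hDD : ∀ β, (∀ i, fconj i (-(β i)) ≠ ⊤) → D β = ((Dr β : ℝ) : EReal) := by
    intro β hβ
    rw [hD]
    have h1 : ∑ i, -(fconj i (-(β i))) = ((∑ i, -(fr i (-(β i))) : ℝ) : EReal) := by
      rw [ps_coe_sum]
      refine Finset.sum_congr rfl fun i _ => ?_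
      rw [hfrc i _ (hβ i), EReal.coe_neg]
    rw [h1, ← EReal.coe_mul, ← EReal.coe_sub]
    rfl
  have hwv : ∀ (w : Fin d → ℝ) β, lam * (w ⬝ᵥ vmap β) =
      (1 / n : ℝ) * ∑ i, w ⬝ᵥ (X i).mulVec (β i) := by
    intro w β
    rw [hvmap, dotProduct_smul, dotProduct_sum, smul_eq_mul]
    field_simp
  have htr : ∀ i (w : Fin d → ℝ) y,
      w ⬝ᵥ (X i).mulVec y = (X i).transpose.mulVec w ⬝ᵥ y := by
    intro i w y
    rw [Matrix.mulVec_transpose, Matrix.dotProduct_mulVec]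
  -- weak duality
  have hweak : ∀ β w, D β ≤ ((P w : ℝ) : EReal) := by
    intro β w
    by_cases hβ : ∀ i, fconj i (-(β i)) ≠ ⊤
    · rw [hDD β hβ, EReal.coe_le_coe_iff, hP]
      simp only [hDr]
      have h1 : ∑ i, -(fr i (-(β i))) ≤
          ∑ i, (φ i ((X i).transpose.mulVec w) + w ⬝ᵥ (X i).mulVec (β i)) := by
        refine Finset.sum_le_sum fun i _ => ?_
        have := hfle i _ _ (hfrc i _ (hβ i)) ((X i).transpose.mulVec w)
        rw [dotProduct_neg] at this
        rw [htr]
        linarith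
      rw [Finset.sum_add_distrib] at h1
      have h2 : w ⬝ᵥ vmap β - g w ≤ gs (vmap β) := hGgrad (vmap β) w
      have h3 := mul_le_mul_of_nonneg_left h2 hlam.le
      have h4 := mul_le_mul_of_nonneg_left h1 (by positivity : 0 ≤ (1 / n : ℝ))
      rw [mul_sub, hwv] at h3
      linarith
    · push Not at hβ
      obtain ⟨i, hi⟩ := hβ
      have h1 : ∑ i, -(fconj i (-(β i))) = ⊥ := by
        rw [← Finset.add_sum_erase _ _ (Finset.mem_univ i), hi, EReal.neg_top, EReal.bot_add]
      rw [hD, h1, EReal.coe_mul_bot_of_pos (by positivity), EReal.bot_sub]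
      exact bot_le
  -- reference value
  set c : ℝ := ⨅ w, P w with hc
  have hP0 : ∀ w, 0 ≤ P w := by
    intro w
    rw [hP]
    have h1 : 0 ≤ ∑ i, φ i ((X i).transpose.mulVec w) :=
      Finset.sum_nonneg fun i _ => hφnonneg i _
    have := hgnonneg w
    positivity
  have hcP : ∀ w, c ≤ P w := fun w => ciInf_le ⟨0, by rintro _ ⟨w, rfl⟩; exact hP0 w⟩ w
  have hDc : ∀ β, D β ≤ (c : EReal) := by
    intro β
    by_cases hb : D β = ⊥
    · rw [hb]; exact bot_le
    · have htop : D β ≠ ⊤ := by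
        intro h
        have := hweak β 0
        rw [h, top_le_iff] at this
        exact EReal.coe_ne_top _ this
      have h1 := EReal.coe_toReal htop hb
      rw [← h1, EReal.coe_le_coe_iff]
      refine le_ciInf fun w => ?_
      have := hweak β w
      rw [← h1, EReal.coe_le_coe_iff] at this
      exact this
  -- one step
  have hone : ∀ ω t, (∀ i, fconj i (-(αseq ω t i)) ≠ ⊤) →
      (∀ i, fconj i (-(αseq ω (t + 1) i)) ≠ ⊤) ∧
      ∀ s : ℝ, 0 ≤ s → s ≤ 1 →
        Dr (αseq ω t) + (1 / n : ℝ) * (s * (φ (ω t) ((X (ω t)).transpose.mulVec (Ggrad (vmap (αseq ω t))))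
          + fr (ω t) (-(αseq ω t (ω t))) + Ggrad (vmap (αseq ω t)) ⬝ᵥ (X (ω t)).mulVec (αseq ω t (ω t)))
          - s ^ 2 * (1 / (2 * lam * n) * (2 * R * L) ^ 2)) ≤ Dr (αseq ω (t + 1)) := by
    intro ω t hfin
    obtain ⟨Δ, hup, hmax⟩ := hupdate ω t
    set i := ω t with hi
    set β := αseq ω t with hβ
    set w := Ggrad (vmap β) with hw
    obtain ⟨c', hc', hs⟩ := ps_one_step R L (1 / (2 * lam * n)) hR (by positivity) NP ND
      hNP_smul hND ND' hND'0 (X i) (hXR i) (φ i) (hφconv i) (hφlip i) (fconj i) (hfconj i)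
      w (β i) Δ (fr i (-(β i))) (hfrc i _ (hfin i)) (by
        intro Δ'
        have := hmax Δ'
        rw [hobj, hobj] at this
        exact this)
    have hupi : αseq ω (t + 1) i = β i + Δ := by rw [hup, Function.update_self]
    have hupj : ∀ j, j ≠ i → αseq ω (t + 1) j = β j := by
      intro j hj
      rw [hup, Function.update_of_ne hj]
    refine ⟨?_, ?_⟩
    · intro j
      by_cases hj : j = i
      · rw [hj, hupi, hc']; exact EReal.coe_ne_top _
      · rw [hupj j hj]; exact hfin j
    · intro s hs0 hs1
      have h1 := hs s hs0 hs1
      have hsum : ∑ j, -(fr j (-(αseq ω (t + 1) j))) - ∑ j, -(fr j (-(β j))) =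
          -c' + fr i (-(β i)) := by
        rw [← Finset.sum_sub_distrib, Finset.sum_eq_single i]
        · rw [hupi, hfr_of i _ _ hc']; ring
        · intro j _ hj
          rw [hupj j hj]; ring
        · simp
      have hv : vmap (αseq ω (t + 1)) = vmap β + (1 / (lam * n)) • (X i).mulVec Δ := by
        rw [hvmap, hvmap, ← smul_add]
        congr 1
        rw [← sub_eq_iff_eq_add', ← Finset.sum_sub_distrib, Finset.sum_eq_single i]
        · rw [hupi, Matrix.mulVec_add]; abel
        · intro j _ hj
          rw [hupj j hj, sub_self]
        · simp
      have hg := ps_smooth NP' ND' hNP'_nonneg hNP'_eq_zero hNP'_smul hND' g hgsc Ggrad hGgrad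
        (vmap β) ((1 / (lam * n)) • (X i).mulVec Δ)
      rw [← hv] at hg
      have hg' : gs (vmap (αseq ω (t + 1))) ≤ gs (vmap β) +
          w ⬝ᵥ ((1 / (lam * n)) • (X i).mulVec Δ) + ND' ((1 / (lam * n)) • (X i).mulVec Δ) ^ 2 / 2 := hg
      have hN : ND' ((1 / (lam * n)) • (X i).mulVec Δ) ≤ 1 / (lam * n) * ND' ((X i).mulVec Δ) :=
        ps_dual_smul NP' ND' hND' _ (by positivity) _
      have hN2 : ND' ((1 / (lam * n)) • (X i).mulVec Δ) ^ 2 ≤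
          (1 / (lam * n) * ND' ((X i).mulVec Δ)) ^ 2 := by
        have := hND'0 ((1 / (lam * n)) • (X i).mulVec Δ)
        gcongr
      rw [dotProduct_smul, smul_eq_mul] at hg'
      have hg2 : gs (vmap (αseq ω (t + 1))) ≤ gs (vmap β) +
          1 / (lam * n) * (w ⬝ᵥ (X i).mulVec Δ) + (1 / (lam * n) * ND' ((X i).mulVec Δ)) ^ 2 / 2 := by
        linarith
      have hg3 := mul_le_mul_of_nonneg_left hg2 hlam.le
      have e1 : lam * (gs (vmap β) +
          1 / (lam * n) * (w ⬝ᵥ (X i).mulVec Δ) + (1 / (lam * n) * ND' ((X i).mulVec Δ)) ^ 2 / 2)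
          = lam * gs (vmap β) + (1 / n : ℝ) * (w ⬝ᵥ (X i).mulVec Δ +
            1 / (2 * lam * n) * ND' ((X i).mulVec Δ) ^ 2) := by
        field_simp
        ring
      rw [e1] at hg3
      have h2 := mul_le_mul_of_nonneg_left h1 (by positivity : 0 ≤ (1 / n : ℝ))
      have h3 : (1 / n : ℝ) * ∑ j, -(fr j (-(αseq ω (t + 1) j))) =
          (1 / n : ℝ) * ∑ j, -(fr j (-(β j))) + (1 / n : ℝ) * (-c' + fr i (-(β i))) := by
        rw [← hsum]; ring
      simp only [hDr]
      rw [h3]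
      linarith
  have hz0 : ∀ i, fconj i 0 ≤ ((0 : ℝ) : EReal) := by
    intro i
    rw [hfconj]
    refine iSup_le fun x => ?_
    rw [EReal.coe_le_coe_iff]
    have := hφnonneg i x
    simp
    exact this
  have hfin : ∀ ω t, ∀ i, fconj i (-(αseq ω t i)) ≠ ⊤ := by
    intro ω t
    induction t with
    | zero =>
      intro i h
      rw [hinit, Pi.zero_apply, neg_zero] at h
      have := hz0 i
      rw [h, top_le_iff] at this
      exact EReal.coe_ne_top _ this
    | succ t ih => exact (hone ω t ih).1
  have hDα : ∀ ω t, D (αseq ω t) = ((Dr (αseq ω t) : ℝ) : EReal) := fun ω t =>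
    hDD _ (hfin ω t)
  have hDrc : ∀ ω t, Dr (αseq ω t) ≤ c := by
    intro ω t
    have := hDc (αseq ω t)
    rw [hDα, EReal.coe_le_coe_iff] at this
    exact this
  -- duality gap
  have hgapeq : ∀ β, P (Ggrad (vmap β)) - Dr β = (1 / n : ℝ) * ∑ i,
      (φ i ((X i).transpose.mulVec (Ggrad (vmap β))) + fr i (-(β i))
        + Ggrad (vmap β) ⬝ᵥ (X i).mulVec (β i)) := by
    intro β
    rw [hP]
    simp only [hDr, hgs]
    rw [Finset.sum_add_distrib, Finset.sum_add_distrib, mul_add, mul_add, ← hwv,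
      Finset.sum_neg_distrib]
    ring
  have hstepω : ∀ ω t (s : ℝ), 0 ≤ s → s ≤ 1 →
      (1 / n : ℝ) * ∑ i, (c - Dr (αseq (Function.update ω t i) (t + 1))) ≤
        (c - Dr (αseq ω t)) + (- (s / n)) * (P (Ggrad (vmap (αseq ω t))) - Dr (αseq ω t))
          + (s / n) ^ 2 * (2 * (R * L) ^ 2 / lam) := by
    intro ω t s hs0 hs1
    set β := αseq ω t with hβ
    have h1 : ∀ i, c - Dr (αseq (Function.update ω t i) (t + 1)) ≤ (c - Dr β
        + (s / n) ^ 2 * (2 * (R * L) ^ 2 / lam))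
        - (s / n) * (φ i ((X i).transpose.mulVec (Ggrad (vmap β))) + fr i (-(β i))
        + Ggrad (vmap β) ⬝ᵥ (X i).mulVec (β i)) := by
      intro i
      have h2 := (hone (Function.update ω t i) t (hfin _ t)).2 s hs0 hs1
      have h3 : αseq (Function.update ω t i) t = β :=
        hadapt _ _ _ fun r hr => Function.update_of_ne hr.ne _ _
      rw [h3, Function.update_self] at h2
      have e1 : (1 / n : ℝ) * (s ^ 2 * (1 / (2 * lam * n) * (2 * R * L) ^ 2)) =
          (s / n) ^ 2 * (2 * (R * L) ^ 2 / lam) := by field_simp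
      have e2 : (1 / n : ℝ) * s = s / n := by ring
      rw [mul_sub, e1, ← mul_assoc, e2] at h2
      linarith
    have h4 := Finset.sum_le_sum (s := Finset.univ) fun i _ => h1 i
    have h5 := mul_le_mul_of_nonneg_left h4 (by positivity : 0 ≤ (1 / n : ℝ))
    refine h5.trans (le_of_eq ?_)
    rw [Finset.sum_sub_distrib, ← Finset.mul_sum, hgapeq]
    simp only [Finset.sum_const, Finset.card_univ, Fintype.card_fin, nsmul_eq_mul]
    field_simp
    ring
  -- expectations
  set e : ℕ → ℝ := fun t => psAvg hn t (fun ω => c - Dr (αseq ω t)) with he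
  set γ : ℕ → ℝ := fun t => psAvg hn t
    (fun ω => P (Ggrad (vmap (αseq ω t))) - Dr (αseq ω t)) with hγ
  have hA : 0 < (R * L) ^ 2 := by positivity
  have hstep : ∀ t (s : ℝ), 0 ≤ s → s ≤ 1 →
      e (t + 1) ≤ e t - s / n * γ t + (s / n) ^ 2 * (2 * (R * L) ^ 2 / lam) := by
    intro t s hs0 hs1
    simp only [he, hγ]
    rw [psAvg_succ]
    refine (psAvg_mono hn t fun ω => hstepω ω t s hs0 hs1).trans (le_of_eq ?_)
    rw [psAvg_add, psAvg_add, psAvg_mul, psAvg_const]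
    ring
  have heγ : ∀ t, e t ≤ γ t := fun t => psAvg_mono hn t fun ω => by
    have := hcP (Ggrad (vmap (αseq ω t)))
    linarith
  have he_nonneg : ∀ t, 0 ≤ e t := fun t => by
    have := psAvg_mono hn t (F := fun _ => 0) (G := fun ω => c - Dr (αseq ω t))
      fun ω => sub_nonneg.2 (hDrc ω t)
    rwa [psAvg_const] at this
  have he0 : e 0 ≤ 1 := by
    have h1 : ∀ ω, c - Dr (αseq ω 0) ≤ 1 := by
      intro ω
      have h2 : c ≤ 1 := by
        refine (hcP 0).trans ?_
        rw [hP, hgzero]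
        simpa using hφzero
      have h3 : 0 ≤ Dr (αseq ω 0) := by
        rw [hinit]
        simp only [hDr]
        have h4 : vmap 0 = 0 := by rw [hvmap]; simp
        have h5 : gs (vmap 0) ≤ 0 := by
          rw [h4]
          simp only [hgs, dotProduct_zero]
          linarith [hgnonneg (Ggrad 0)]
        have h6 : 0 ≤ ∑ i, -(fr i (-((0 : Fin n → Fin k → ℝ) i))) := by
          refine Finset.sum_nonneg fun i _ => ?_
          have h7 := hz0 i
          have h8 : fconj i 0 ≠ ⊤ := by
            intro h
            rw [h, top_le_iff] at h7
            exact EReal.coe_ne_top _ h7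
          rw [hfrc i 0 h8, EReal.coe_le_coe_iff] at h7
          rw [Pi.zero_apply, neg_zero]
          linarith
        have h9 : lam * gs (vmap 0) ≤ 0 := mul_nonpos_of_nonneg_of_nonpos hlam.le h5
        have : 0 ≤ (1 / n : ℝ) * ∑ i, -(fr i (-((0 : Fin n → Fin k → ℝ) i))) := by positivity
        linarith
      linarith
    have := psAvg_mono hn 0 (F := fun ω => c - Dr (αseq ω 0)) (G := fun _ => 1) h1
    rwa [psAvg_const] at this
  have hrec := ps_rec n hn lam ((R * L) ^ 2) hlam hA e γ he0 heγ hstep t₀ ht₀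
  refine ⟨?_, ?_⟩
  · intro T₀ T hT₀ hT
    have h1T : t₀ ≤ T₀ := by
      have := (le_max_left _ _).trans hT₀
      exact_mod_cast this
    have hgap := ps_gap n hn lam ((R * L) ^ 2) εP hlam hA hεP e γ he_nonneg hstep t₀ T₀ T hT₀ hT
      (hrec T₀ h1T)
    have hγT : ∀ t ∈ Finset.Icc (T₀ + 1) T, γ (t - 1) = psAvg hn T
        (fun ω => P (Ggrad (vmap (αseq ω (t - 1)))) - Dr (αseq ω (t - 1))) := by
      intro t ht
      rw [Finset.mem_Icc] at ht
      refine (psAvg_stable hn (t - 1) T (by omega) _ ?_).symm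
      intro ω ω' h
      rw [hadapt ω ω' (t - 1) h]
    rw [Finset.sum_congr rfl hγT, ← psAvg_sum, ← psAvg_mul] at hgap
    have hgE := EReal.coe_le_coe_iff.2 hgap
    refine le_trans (le_of_eq ?_) hgE
    simp only [psAvg, EReal.coe_mul, ps_coe_sum, hDα, EReal.coe_sub]
    rfl
  · intro αstar hstar t ht
    have hgE := EReal.coe_le_coe_iff.2 (hrec t ht)
    refine le_trans ?_ hgE
    simp only [he, psAvg, EReal.coe_mul, ps_coe_sum]
    refine mul_le_mul_of_nonneg_left ?_ (EReal.coe_nonneg.2 (by positivity))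
    refine Finset.sum_le_sum fun σ _ => ?_
    rw [hDα, EReal.coe_sub]
    exact EReal.sub_le_sub (hDc _) le_rfl
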